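/- For every a ∈ [0,1], the function f_a : [0,1] → [0,1] is continuous at every Q*_s-unary point x_0 ∈ [0,1] (every point having a unique Q*_s-representation). -/

import Mathlib

open Filter Topology MeasureTheory Set

set_option linter.unusedVariables false

/-- β_{k,n} = Σ_{i<k} q_{i,n}. -/
noncomputable def qbeta (s : ℕ) (q : Fin s → ℕ → ℝ) (k : Fin s) (n : ℕ) : ℝ :=
  ∑ i : Fin s, if i < k then q i n else 0

/-- Δ(α) = β_{α_1,1} + Σ_{n≥2} β_{α_n,n} Π_{j<n} q_{α_j,j}, with positions indexed from 0. -/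
noncomputable def Delta (s : ℕ) (q : Fin s → ℕ → ℝ) (α : ℕ → Fin s) : ℝ :=
  ∑' n : ℕ, qbeta s q (α n) n * ∏ j ∈ Finset.range n, q (α j) j

/-- the digit |a − b|. -/
def adiff {s : ℕ} (a b : Fin s) : Fin s :=
  ⟨a.1 - b.1 + (b.1 - a.1), by have ha := a.2; have hb := b.2; omega⟩

section DeltaContinuity

variable {s : ℕ} {q : Fin s → ℕ → ℝ}

lemma qbeta_nonneg (hq0 : ∀ i n, 0 < q i n) (k : Fin s) (n : ℕ) : 0 ≤ qbeta s q k n :=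
  Finset.sum_nonneg fun i _ => by split_ifs <;> [exact (hq0 i n).le; rfl]

lemma qbeta_add_le_one (hq0 : ∀ i n, 0 < q i n) (hqsum : ∀ n, ∑ i : Fin s, q i n = 1)
    (k : Fin s) (n : ℕ) : qbeta s q k n + q k n ≤ 1 := by
  have hk : q k n = ∑ i : Fin s, if i = k then q i n else 0 := by simp
  rw [qbeta, hk, ← Finset.sum_add_distrib, ← hqsum n]
  refine Finset.sum_le_sum fun i _ => ?_
  rcases lt_trichotomy i k with h | h | h
  · simp [h, h.ne]
  · simp [h]
  · simp [h.not_gt, h.ne', (hq0 i n).le]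

lemma antitone_partialSum_add_prod (hq0 : ∀ i n, 0 < q i n)
    (hqsum : ∀ n, ∑ i : Fin s, q i n = 1) (α : ℕ → Fin s) :
    Antitone fun N : ℕ =>
      (∑ n ∈ Finset.range N, qbeta s q (α n) n * ∏ j ∈ Finset.range n, q (α j) j)
        + ∏ j ∈ Finset.range N, q (α j) j := by
  refine antitone_nat_of_succ_le fun N => ?_
  have hP : 0 ≤ ∏ j ∈ Finset.range N, q (α j) j := Finset.prod_nonneg fun j _ => (hq0 _ _).le
  simp only [Finset.sum_range_succ, Finset.prod_range_succ]
  nlinarith [mul_le_mul_of_nonneg_right (qbeta_add_le_one hq0 hqsum (α N) N) hP]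

lemma Delta_term_nonneg (hq0 : ∀ i n, 0 < q i n) (α : ℕ → Fin s) (n : ℕ) :
    0 ≤ qbeta s q (α n) n * ∏ j ∈ Finset.range n, q (α j) j :=
  mul_nonneg (qbeta_nonneg hq0 _ _) (Finset.prod_nonneg fun _ _ => (hq0 _ _).le)

lemma summable_Delta (hq0 : ∀ i n, 0 < q i n) (hqsum : ∀ n, ∑ i : Fin s, q i n = 1)
    (α : ℕ → Fin s) :
    Summable fun n : ℕ => qbeta s q (α n) n * ∏ j ∈ Finset.range n, q (α j) j := by
  refine summable_of_sum_range_le (c := 1) (Delta_term_nonneg hq0 α) fun N => ?_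
  have h := antitone_partialSum_add_prod hq0 hqsum α (Nat.zero_le N)
  have hP : 0 ≤ ∏ j ∈ Finset.range N, q (α j) j := Finset.prod_nonneg fun j _ => (hq0 _ _).le
  simp only [Finset.range_zero, Finset.sum_empty, Finset.prod_empty] at h
  linarith

lemma abs_Delta_sub_partialSum_le (hq0 : ∀ i n, 0 < q i n)
    (hqsum : ∀ n, ∑ i : Fin s, q i n = 1) (α : ℕ → Fin s) (N : ℕ) :
    |Delta s q α - ∑ n ∈ Finset.range N, qbeta s q (α n) n * ∏ j ∈ Finset.range n, q (α j) j|
      ≤ ∏ n ∈ Finset.range N, ⨆ i : Fin s, q i n := by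
  have hsum := summable_Delta hq0 hqsum α
  have hlow : ∑ n ∈ Finset.range N, qbeta s q (α n) n * ∏ j ∈ Finset.range n, q (α j) j
      ≤ Delta s q α :=
    hsum.sum_le_tsum (Finset.range N) fun n _ => Delta_term_nonneg hq0 α n
  have hup : Delta s q α ≤
      (∑ n ∈ Finset.range N, qbeta s q (α n) n * ∏ j ∈ Finset.range n, q (α j) j)
        + ∏ j ∈ Finset.range N, q (α j) j := by
    refine le_of_tendsto hsum.hasSum.tendsto_sum_nat ?_
    filter_upwards [eventually_ge_atTop N] with M hM
    have hP : 0 ≤ ∏ j ∈ Finset.range M, q (α j) j :=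
      Finset.prod_nonneg fun j _ => (hq0 _ _).le
    have h := antitone_partialSum_add_prod hq0 hqsum α hM
    dsimp only at h
    linarith
  have hmax : ∏ j ∈ Finset.range N, q (α j) j ≤ ∏ n ∈ Finset.range N, ⨆ i : Fin s, q i n :=
    Finset.prod_le_prod (fun j _ => (hq0 _ _).le) fun j _ =>
      le_ciSup (f := fun i => q i j) (Set.finite_range _).bddAbove (α j)
  rw [abs_of_nonneg (sub_nonneg.2 hlow)]
  linarith

lemma continuous_Delta (hq0 : ∀ i n, 0 < q i n) (hqsum : ∀ n, ∑ i : Fin s, q i n = 1)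
    (hqprod : Tendsto (fun N => ∏ n ∈ Finset.range N, ⨆ i : Fin s, q i n) atTop (𝓝 0)) :
    Continuous (Delta s q) := by
  have hunif : TendstoUniformly
      (fun N (α : ℕ → Fin s) =>
        ∑ n ∈ Finset.range N, qbeta s q (α n) n * ∏ j ∈ Finset.range n, q (α j) j)
      (Delta s q) atTop := by
    rw [Metric.tendstoUniformly_iff]
    intro ε hε
    filter_upwards [hqprod.eventually_lt_const hε] with N hN α
    exact (abs_Delta_sub_partialSum_le hq0 hqsum α N).trans_lt hN
  refine hunif.continuous (Frequently.of_forall fun N => ?_)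
  refine continuous_finsetSum _ fun n _ => Continuous.mul ?_ (continuous_finsetProd _ fun j _ => ?_)
  · exact (continuous_of_discreteTopology (f := fun k => qbeta s q k n)).comp (continuous_apply n)
  · exact (continuous_of_discreteTopology (f := fun k => q k j)).comp (continuous_apply j)

end DeltaContinuity

/-- A section of a continuous map from a compact space to a Hausdorff space is continuous at
every point with a single preimage. -/
lemma tendsto_section_of_unique_preimage {X Y : Type*} [TopologicalSpace X] [CompactSpace X]
    [TopologicalSpace Y] [T2Space Y] {g : X → Y} (hg : Continuous g) {S : Set Y} {D : Y → X}
    (hD : ∀ y ∈ S, g (D y) = y) {y₀ : Y} {x₀ : X} (huniq : ∀ x, g x = y₀ → x = x₀) :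
    Tendsto D (𝓝[S] y₀) (𝓝 x₀) := by
  refine le_nhds_of_unique_clusterPt fun x hx => huniq x ?_
  have hgD : Tendsto g (map D (𝓝[S] y₀)) (𝓝 y₀) := by
    refine tendsto_map'_iff.2 ((tendsto_id.mono_left nhdsWithin_le_nhds).congr' ?_)
    filter_upwards [self_mem_nhdsWithin] with y hy using (hD y hy).symm
  have hcl : ClusterPt (g x) (𝓝 y₀) := hx.map hg.continuousAt hgD
  exact eq_of_nhds_neBot hcl

/-- for every a ∈ [0,1], the function f_a(x) = Δ((|a_n − α_n(x)|)) is
continuous (within [0,1]) at every Q*_s-unary point x₀ ∈ [0,1].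
Here D x is the canonical digit sequence α(x) of x, characterized by its properties. -/
theorem stmt9 (s : ℕ) (hs : 2 ≤ s) (q : Fin s → ℕ → ℝ)
    (hq0 : ∀ i n, 0 < q i n) (hq1 : ∀ i n, q i n < 1)
    (hqsum : ∀ n, ∑ i : Fin s, q i n = 1)
    (hqprod : Filter.Tendsto (fun N => ∏ n ∈ Finset.range N, ⨆ i : Fin s, q i n)
      Filter.atTop (nhds 0))
    (D : ℝ → ℕ → Fin s)
    (hD : ∀ x ∈ Set.Icc (0 : ℝ) 1, Delta s q (D x) = x)
    (hDcanon : ∀ x ∈ Set.Icc (0 : ℝ) 1, x ≠ 1 → ¬ ∃ N, ∀ n ≥ N, ((D x n : ℕ) = s - 1))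
    (hD1 : ∀ n, ((D 1 n : ℕ) = s - 1))
    (a : ℝ) (ha : a ∈ Set.Icc (0 : ℝ) 1) (aseq : ℕ → Fin s)
    (haseq : a = ∑' n : ℕ, (aseq n : ℝ) / (s : ℝ) ^ (n + 1))
    (f : ℝ → ℝ) (hf : ∀ x, f x = Delta s q (fun n => adiff (aseq n) (D x n)))
    (x₀ : ℝ) (hx₀ : x₀ ∈ Set.Icc (0 : ℝ) 1)
    (hrep : ∃ γ : ℕ → Fin s, Delta s q γ = x₀)
    (hunary : ∀ γ δ : ℕ → Fin s, Delta s q γ = x₀ → Delta s q δ = x₀ → γ = δ) :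
    ContinuousWithinAt f (Set.Icc 0 1) x₀ := by
  have hcont := continuous_Delta hq0 hqsum hqprod
  have hDx₀ : Tendsto D (𝓝[Icc 0 1] x₀) (𝓝 (D x₀)) :=
    tendsto_section_of_unique_preimage hcont hD fun γ hγ => hunary _ _ hγ (hD x₀ hx₀)
  have hdiff : Continuous fun (α : ℕ → Fin s) n => adiff (aseq n) (α n) :=
    continuous_pi fun n =>
      (continuous_of_discreteTopology (f := fun k => adiff (aseq n) k)).comp (continuous_apply n)
  rw [funext hf]
  exact ((hcont.comp hdiff).tendsto (D x₀)).comp hDx₀
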